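/- Let P_t and P_{t+1} be orthogonal projectors on a finite-dimensional Hilbert space, and suppose the minimal Jordan overlap between vectors in range(P_t) and range(P_{t+1}) satisfies d_min := min_{ψ ∈ range(P_t), ‖ψ‖=1} max_{φ ∈ range(P_{t+1}), ‖φ‖=1} |⟨ψ|φ⟩|² > 0. Then the iterated alternating-measurement scheme starting from any unit ψ ∈ range(P_t) reaches range(P_{t+1}) within m rounds except with probability strictly less than 1/(2 d_min m). -/

import Mathlib

open scoped InnerProductSpace

theorem scal (x d : ℝ) (m : ℕ) (hm : 1 ≤ m) (hd : 0 < d) (h0 : 0 ≤ x) (h1 : x ≤ 1 - d) :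
    x * (1 - 2*x + 2*x^2)^m < 1/(2*d*m) := by
  have hm' : (1:ℝ) ≤ m := by exact_mod_cast hm
  rcases h0.eq_or_lt with rfl | hx
  · simp; positivity
  set u := 2*x*(1-x) with hu
  have hu0 : 0 < u := by have : 0 < 1 - x := by linarith
                         positivity
  have hg : 1 - 2*x+2*x^2 = 1 - u := by rw [hu]; ring
  have hg0 : 0 < 1 - 2*x+2*x^2 := by nlinarith [sq_nonneg (2*x-1)]
  have hb : 1 + m * u ≤ (1+u)^m := one_add_mul_le_pow (by linarith) m
  have hp : (1+u)^m * (1-u)^m ≤ 1 := by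
    rw [← mul_pow]; apply pow_le_one₀ <;> nlinarith
  rw [hg] at hg0 ⊢
  have hq : 0 < (1-u)^m := pow_pos hg0 m
  rw [lt_div_iff₀ (by positivity)]
  have h3 : x * (2*d*m) ≤ m * u := by
    have : x * d ≤ x * (1-x) := by nlinarith
    rw [hu]; nlinarith
  nlinarith

theorem rk {H : Type*} [NormedAddCommGroup H] [InnerProductSpace ℂ H]
    [FiniteDimensional ℂ H] (A : H →ₗ[ℂ] H) (ψ : H) :
    (LinearMap.trace ℂ H (A ∘ₗ (((innerSL ℂ ψ).toLinearMap).smulRight ψ) ∘ₗ LinearMap.adjoint A)).re = ‖A ψ‖^2 := by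
  have : A ∘ₗ (((innerSL ℂ ψ).toLinearMap).smulRight ψ) ∘ₗ LinearMap.adjoint A
    = ((innerSL ℂ (A ψ)).toLinearMap).smulRight (A ψ) := by
    ext x
    simp [LinearMap.adjoint_inner_right]
  rw [this, LinearMap.trace_smulRight]
  simp
  norm_cast

theorem walk {H : Type*} [NormedAddCommGroup H] [InnerProductSpace ℂ H]
    [FiniteDimensional ℂ H] (P Q : Module.End ℂ H)
    (hQ : Q * Q = Q) (hC : IsSelfAdjoint (Q * P * Q)) (m : ℕ) : ∀ v : H, Q v = v →
    ∑ s : Fin m → Bool, ‖((List.ofFn fun i : Fin m =>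
              Q * (if s (i.rev) then P else 1 - P)).prod : Module.End ℂ H) v‖^2
      = (⟪v, ((1 - 2 * (Q*P*Q) + 2 * (Q*P*Q)^2)^m : Module.End ℂ H) v⟫_ℂ).re := by
  induction m with
  | zero => intro v hv; simp; norm_cast
  | succ m ih =>
    intro v hv
    rw [← (Fin.consEquiv (fun _ : Fin (m+1) => Bool)).sum_comp, Fintype.sum_prod_type]
    simp only [List.ofFn_succ', Fin.consEquiv_apply, Fin.rev_last, Fin.cons_zero, Fin.rev_castSucc, Fin.cons_succ, List.concat_eq_append, List.prod_append, List.prod_singleton, Module.End.mul_apply (_ : Module.End ℂ H) (_ * _ : Module.End ℂ H)]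
    rw [Fintype.sum_bool]
    have hQQ : ∀ x, Q (Q x) = Q x := fun x => by rw [← Module.End.mul_apply, hQ]
    have e1 : (Q * P) v = (Q*P*Q) v := by simp [hv]
    have e2 : (Q * (1-P)) v = (1 - Q*P*Q) v := by simp [hv]
    simp only [if_true, Bool.false_eq_true, if_false]
    rw [ih _ (by simp [hQQ]), ih _ (by simp [hQQ]), e1, e2]
    set C := Q*P*Q
    set G : Module.End ℂ H := 1 - 2*C+2*C^2 with hG
    have hs : ∀ x y, ⟪C x, y⟫_ℂ = ⟪x, C y⟫_ℂ :=
      (LinearMap.isSymmetric_iff_isSelfAdjoint C).2 hC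
    have hs' : ∀ x y, ⟪(1-C) x, y⟫_ℂ = ⟪x, (1-C) y⟫_ℂ := fun x y => by
      simp [inner_sub_left, inner_sub_right, hs]
    rw [hs, hs', ← Complex.add_re, ← inner_add_right]
    have hc : Commute C G := by
      rw [hG]
      exact ((Commute.one_right C).sub_right ((Commute.ofNat_right C 2).mul_right (Commute.refl C))).add_right
        ((Commute.ofNat_right C 2).mul_right ((Commute.refl C).pow_right 2))
    have hc' : C * G^m = G^m * C := (hc.pow_right m).eq
    congr 2
    simp only [← Module.End.mul_apply]
    rw [← LinearMap.add_apply]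
    congr 1
    have : C * (G^m * C) + (1-C)*(G^m*(1-C)) = G^m * (C*C + (1-C)*(1-C)) := by
      simp only [mul_add, mul_sub, sub_mul, one_mul, mul_one, ← hc', ← mul_assoc]
      rw [show C * G^m * C = C * C * G^m by rw [mul_assoc C (G^m) C, ← hc', ← mul_assoc]]
    rw [this, pow_succ, hG]
    congr 1
    noncomm_ring

theorem eigPow {H : Type*} [NormedAddCommGroup H] [InnerProductSpace ℂ H]
    (G : Module.End ℂ H) (e : H) (c : ℂ) (h : G e = c • e) (m : ℕ) : (G ^ m) e = c ^ m • e := by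
  induction m with
  | zero => simp
  | succ m ih => rw [pow_succ, Module.End.mul_apply, h, map_smul, ih, smul_smul, pow_succ']

theorem specBound {H : Type*} [NormedAddCommGroup H] [InnerProductSpace ℂ H]
    [FiniteDimensional ℂ H] (D : Module.End ℂ H) (hD : IsSelfAdjoint D) (B : ℝ) (m : ℕ)
    (hB : ∀ (e : H) (μ : ℝ), ‖e‖ = 1 → D e = (μ : ℂ) • e →
      μ * (1 - 2 * μ + 2 * μ ^ 2) ^ m < B) (ψ : H) (hψ : ‖ψ‖ = 1) :
    (⟪ψ, (D * (1 - 2 * D + 2 * D ^ 2) ^ m : Module.End ℂ H) ψ⟫_ℂ).re < B := by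
  have hS : LinearMap.IsSymmetric D := (LinearMap.isSymmetric_iff_isSelfAdjoint D).2 hD
  set b := hS.eigenvectorBasis rfl
  set μ := hS.eigenvalues rfl
  have hb : ∀ i, D (b i) = ((μ i : ℝ) : ℂ) • b i := hS.apply_eigenvectorBasis rfl
  have h2 : ∀ x : H, (2 : Module.End ℂ H) x = (2 : ℂ) • x := fun x => by
    rw [Module.End.ofNat_apply]; norm_num [two_smul]
  have hG : ∀ i, (1 - 2 * D + 2 * D ^ 2 : Module.End ℂ H) (b i)
      = (1 - 2 * (μ i : ℂ) + 2 * (μ i : ℂ) ^ 2) • b i := fun i => by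
    simp only [LinearMap.add_apply, LinearMap.sub_apply, Module.End.mul_apply, pow_two,
      Module.End.one_apply, hb, map_smul, h2]
    module
  set f : Fin (Module.finrank ℂ H) → ℝ := fun i => μ i * (1 - 2 * μ i + 2 * μ i ^ 2) ^ m
  set K : Module.End ℂ H := D * (1 - 2 * D + 2 * D ^ 2) ^ m
  have hK : ∀ i, K (b i) = (f i : ℂ) • b i := fun i => by
    simp only [K, f]
    rw [Module.End.mul_apply, eigPow _ _ _ (hG i), map_smul, hb, smul_smul]
    push_cast
    ring_nf
  have hval : (⟪ψ, K ψ⟫_ℂ).re = ∑ i, ‖⟪b i, ψ⟫_ℂ‖ ^ 2 * f i := by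
    conv_lhs => rw [← b.sum_repr' ψ, map_sum]
    rw [b.sum_repr', inner_sum, Complex.re_sum]
    refine Finset.sum_congr rfl fun i _ => ?_
    rw [map_smul, hK, inner_smul_right, inner_smul_right, ← inner_conj_symm ψ (b i)]
    rw [show ⟪b i, ψ⟫_ℂ * ((f i : ℂ) * (starRingEnd ℂ) ⟪b i, ψ⟫_ℂ)
      = (⟪b i, ψ⟫_ℂ * (starRingEnd ℂ) ⟪b i, ψ⟫_ℂ) * (f i : ℂ) by ring, Complex.mul_conj,
      Complex.normSq_eq_norm_sq]
    norm_cast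
  have hone : ∑ i, ‖⟪b i, ψ⟫_ℂ‖ ^ 2 = 1 := by rw [b.sum_sq_norm_inner_right, hψ]; norm_num
  have hlt : ∀ i, f i < B := fun i => hB (b i) (μ i) (b.norm_eq_one i) (hb i)
  rw [hval]
  have : B = ∑ i, ‖⟪b i, ψ⟫_ℂ‖ ^ 2 * B := by rw [← Finset.sum_mul, hone, one_mul]
  rw [this]
  apply Finset.sum_lt_sum
  · intro i _
    exact mul_le_mul_of_nonneg_left (hlt i).le (by positivity)
  · by_contra! hcon
    have hz : ∀ i, ‖⟪b i, ψ⟫_ℂ‖ ^ 2 = 0 := fun i => by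
      by_contra hne
      have hp : 0 < ‖⟪b i, ψ⟫_ℂ‖ ^ 2 := lt_of_le_of_ne (by positivity) (Ne.symm hne)
      exact absurd (hcon i (Finset.mem_univ i)) (not_le.2 (mul_lt_mul_of_pos_left (hlt i) hp))
    simp [hz] at hone

/-- Let `P` (= `P_t`) and `P'` (= `P_{t+1}`) be orthogonal
projectors, and suppose every unit vector in `range P` has squared overlap at
least `d_min > 0` with some unit vector of `range P'`.  Then, starting from
any unit `ψ ∈ range P`, the alternating-measurement scheme reaches
`range P'` within `m` rounds except with probability strictly less than
`1/(2 d_min m)`; the failure probability is the total trajectory sum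
`∑_{s∈{0,1}^m} tr(Q₀R_{s_m}Q₀⋯R_{s₁}Q₀ |ψ⟩⟨ψ| Q₀R_{s₁}⋯Q₀R_{s_m}Q₀)` with
`Q₀ = 1 − P'`, `R₁ = P`, `R₀ = 1 − P`. -/
theorem stmt17 {H : Type*} [NormedAddCommGroup H] [InnerProductSpace ℂ H]
    [FiniteDimensional ℂ H] (P P' : H →ₗ[ℂ] H)
    (hP : P ∘ₗ P = P) (hPa : LinearMap.adjoint P = P)
    (hP' : P' ∘ₗ P' = P') (hP'a : LinearMap.adjoint P' = P')
    (dmin : ℝ) (hdmin : 0 < dmin)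
    (hover : ∀ ψ : H, ‖ψ‖ = 1 → P ψ = ψ →
      ∃ φ : H, ‖φ‖ = 1 ∧ P' φ = φ ∧ dmin ≤ ‖⟪ψ, φ⟫_ℂ‖ ^ 2)
    (ψ : H) (hψ : ‖ψ‖ = 1) (hψP : P ψ = ψ) (m : ℕ) (hm : 1 ≤ m) :
    Complex.re
      (∑ s : Fin m → Bool,
        LinearMap.trace ℂ H
          (((List.ofFn fun i : Fin m =>
              (LinearMap.id - P') ∘ₗ
                (if s (i.rev) then P else LinearMap.id - P)).prod ∘ₗ
              (LinearMap.id - P')) ∘ₗ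
            (((innerSL ℂ ψ).toLinearMap).smulRight ψ) ∘ₗ
            LinearMap.adjoint
              ((List.ofFn fun i : Fin m =>
                  (LinearMap.id - P') ∘ₗ
                    (if s (i.rev) then P else LinearMap.id - P)).prod ∘ₗ
                (LinearMap.id - P'))))
      < 1 / (2 * dmin * m) := by
  simp_rw [Complex.re_sum, rk]
  set Q : Module.End ℂ H := LinearMap.id - P' with hQdef
  have hPP : (P : Module.End ℂ H) * P = P := hP
  have hP'P' : (P' : Module.End ℂ H) * P' = P' := hP'
  have hQ1 : Q = (1 : Module.End ℂ H) - P' := rfl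
  have hPs : IsSelfAdjoint (P : Module.End ℂ H) := hPa
  have hP's : IsSelfAdjoint (P' : Module.End ℂ H) := hP'a
  have hQs : IsSelfAdjoint Q := (IsSelfAdjoint.one _).sub hP's
  have hQQ : Q * Q = Q := by rw [hQ1]; simp [mul_sub, sub_mul, hP'P']
  have hC : IsSelfAdjoint (Q * P * Q) := by
    have := hPs.conjugate Q
    rwa [hQs.star_eq] at this
  have hD : IsSelfAdjoint ((P : Module.End ℂ H) * Q * P) := by
    have := hQs.conjugate (P : Module.End ℂ H)
    rwa [hPs.star_eq] at this
  have hPsym : ∀ x y, ⟪P x, y⟫_ℂ = ⟪x, P y⟫_ℂ :=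
    (LinearMap.isSymmetric_iff_isSelfAdjoint P).2 hPs
  have hQsym : ∀ x y, ⟪Q x, y⟫_ℂ = ⟪x, Q y⟫_ℂ :=
    (LinearMap.isSymmetric_iff_isSelfAdjoint Q).2 hQs
  have hP'sym : ∀ x y, ⟪P' x, y⟫_ℂ = ⟪x, P' y⟫_ℂ :=
    (LinearMap.isSymmetric_iff_isSelfAdjoint P').2 hP's
  have hQQa : ∀ x, Q (Q x) = Q x := fun x => by rw [← Module.End.mul_apply, hQQ]
  have hPPa : ∀ x, P (P x) = P x := fun x => by
    rw [← LinearMap.comp_apply, hP]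
  have hw := walk P Q hQQ hC m (Q ψ) (hQQa ψ)
  refine lt_of_eq_of_lt hw ?_
  -- transfer from `Q P Q` to `P Q P`
  set C : Module.End ℂ H := Q * P * Q with hCdef
  set D : Module.End ℂ H := P * Q * P with hDdef
  have hsc : SemiconjBy (Q * P : Module.End ℂ H) D C := by
    show Q * P * (P * Q * P) = Q * P * Q * (Q * P)
    calc Q * P * (P * Q * P) = Q * (P * P) * Q * P := by simp only [mul_assoc]
      _ = Q * P * (Q * Q) * P := by rw [hPP, hQQ]
      _ = _ := by simp only [mul_assoc]
  have hsG : SemiconjBy (Q * P : Module.End ℂ H) ((1 - 2 * D + 2 * D ^ 2) ^ m)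
      ((1 - 2 * C + 2 * C ^ 2) ^ m) := by
    apply SemiconjBy.pow_right
    have t : SemiconjBy (Q * P : Module.End ℂ H) 2 2 := Commute.ofNat_right _ 2
    exact ((SemiconjBy.one_right _).sub_right (t.mul_right hsc)).add_right
      (t.mul_right (hsc.pow_right 2))
  have hkey : ⟪Q ψ, ((1 - 2 * C + 2 * C ^ 2) ^ m : Module.End ℂ H) (Q ψ)⟫_ℂ
      = ⟪ψ, (D * (1 - 2 * D + 2 * D ^ 2) ^ m : Module.End ℂ H) ψ⟫_ℂ := by
    have e : Q ψ = (Q * P : Module.End ℂ H) ψ := by rw [Module.End.mul_apply, hψP]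
    have e2 : ((1 - 2 * C + 2 * C ^ 2) ^ m : Module.End ℂ H) (Q ψ)
        = (Q * P : Module.End ℂ H) (((1 - 2 * D + 2 * D ^ 2) ^ m : Module.End ℂ H) ψ) := by
      rw [e, ← Module.End.mul_apply, ← hsG.eq, Module.End.mul_apply]
    rw [e2, hQsym, Module.End.mul_apply, hQQa]
    conv_lhs => rw [← hψP]
    rw [hPsym, hψP]
    rfl
  rw [hkey]
  refine specBound D hD _ m ?_ ψ hψ
  intro e μ he hμ
  by_cases h0 : μ = 0
  · subst h0
    have : (1 : ℝ) ≤ m := by exact_mod_cast hm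
    rw [zero_mul]
    positivity
  have hPe : P e = e := by
    have hPD : P (D e) = D e := hPPa _
    rw [hμ, map_smul] at hPD
    exact smul_right_injective H (Complex.ofReal_ne_zero.2 h0) hPD
  have hDe : D e = P (Q e) := by
    show P (Q (P e)) = _
    rw [hPe]
  have hin : (⟪e, D e⟫_ℂ).re = μ := by
    rw [hμ, inner_smul_right, inner_self_eq_norm_sq_to_K, he]
    simp
  have nrm : ∀ x : H, (⟪x, x⟫_ℂ).re = ‖x‖ ^ 2 := fun x => inner_self_eq_norm_sq (𝕜 := ℂ) x
  have hQn : μ = ‖Q e‖ ^ 2 := by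
    rw [← hin, hDe, ← hPsym, hPe, ← nrm, hQsym, hQQa]
  have hP'n : μ = 1 - ‖P' e‖ ^ 2 := by
    have h1 : ⟪e, Q e⟫_ℂ = ⟪e, e⟫_ℂ - ⟪P' e, P' e⟫_ℂ := by
      have : P' (P' e) = P' e := by rw [← LinearMap.comp_apply, hP']
      rw [hP'sym, this, hQ1, LinearMap.sub_apply, inner_sub_right]
      rfl
    rw [← hin, hDe, ← hPsym, hPe, h1, Complex.sub_re, nrm, nrm, he]
    norm_num
  obtain ⟨φ, hφ, hφP, hov⟩ := hover e he hPe
  have hle : ‖⟪e, φ⟫_ℂ‖ ≤ ‖P' e‖ := by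
    rw [← hφP, ← hP'sym]
    have := norm_inner_le_norm (𝕜 := ℂ) (P' e) φ
    rwa [hφ, mul_one] at this
  have hsq : ‖⟪e, φ⟫_ℂ‖ ^ 2 ≤ ‖P' e‖ ^ 2 := by gcongr
  exact scal μ dmin m hm hdmin (by rw [hQn]; positivity) (by linarith)
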